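/- Let f be a fully-connected network in the ReLU-MLP setting of depth L with all hidden widths equal to n and He/fan-in initialization, and fix inputs x₁, x₂ in a compact set. For each layer l ∈ {1, …, L−1}, let Θ^(l)(x₁,x₂) ∈ ℝ^{n×n} denote the empirical NTK of the depth-l sub-network (the layerwise sum of gradient inner products through layer l). Then for every δ > 0 there exist n₀ = O(polylog(L/δ)) and a constant C (independent of n) such that for all n > n₀, with probability at least 1 − δ over the random initialization, ‖Θ^(l)(x₁,x₂)‖_F ≤ C · n^{3/2}. -/

import Mathlib

open MeasureTheory ProbabilityTheory

noncomputable section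

/-- The ReLU activation. -/
def relu (t : ℝ) : ℝ := max t 0

/-- Parameter space of an `L`-layer fully-connected network with widths `w`:
`w 0` is the input dimension and `w L` the output dimension. -/
abbrev Params (L : ℕ) (w : ℕ → ℕ) : Type :=
  (l : Fin L) → Fin (w (l.val + 1)) → Fin (w l.val) → ℝ

/-- Extend a finite family of weight matrices to all layer indices (zero beyond `L`). -/
def extParams {L : ℕ} {w : ℕ → ℕ} (θ : Params L w) (l : ℕ) :
    Fin (w (l + 1)) → Fin (w l) → ℝ :=
  if h : l < L then θ ⟨l, h⟩ else 0

/-- Post-activations of layer `l` (ReLU applied coordinatewise); `layerOut w θ 0 x = x`. -/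
def layerOut (w : ℕ → ℕ) (θ : (l : ℕ) → Fin (w (l + 1)) → Fin (w l) → ℝ) :
    (l : ℕ) → (Fin (w 0) → ℝ) → Fin (w l) → ℝ
  | 0, x => x
  | l + 1, x => fun i => relu (∑ j, θ l i j * layerOut w θ l x j)

/-- Network output: a linear read-out layer on top of `L - 1` ReLU layers. -/
def netOut (w : ℕ → ℕ) (θ : (l : ℕ) → Fin (w (l + 1)) → Fin (w l) → ℝ) :
    (L : ℕ) → (Fin (w 0) → ℝ) → Fin (w L) → ℝ
  | 0, x => x
  | L + 1, x => fun i => ∑ j, θ L i j * layerOut w θ L x j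

/-- The fully-connected network, as a function of its parameters. -/
def fnet (L : ℕ) (w : ℕ → ℕ) (θ : Params L w) (x : Fin (w 0) → ℝ) : Fin (w L) → ℝ :=
  netOut w (extParams θ) L x

/-- Partial derivative of a scalar function of the parameters with respect to the
weight with coordinates `(l, i, j)` (defined via the Fréchet derivative, which exists
almost surely for the networks considered here). -/
def pderiv {L : ℕ} {w : ℕ → ℕ} (F : Params L w → ℝ) (θ : Params L w)
    (l : Fin L) (i : Fin (w (l.val + 1))) (j : Fin (w l.val)) : ℝ :=
  fderiv ℝ F θ (Pi.single l (Pi.single i (Pi.single j (1 : ℝ))))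

/-- The empirical NTK `Θ_θ(x₁, x₂) = J_θ(f_θ(x₁)) J_θ(f_θ(x₂))ᵀ ∈ ℝ^{O×O}`. -/
def eNTK (L : ℕ) (w : ℕ → ℕ) (θ : Params L w) (x₁ x₂ : Fin (w 0) → ℝ) :
    Matrix (Fin (w L)) (Fin (w L)) ℝ := fun i₁ i₂ =>
  ∑ l : Fin L, ∑ a : Fin (w (l.val + 1)), ∑ b : Fin (w l.val),
    pderiv (fun θ' => fnet L w θ' x₁ i₁) θ l a b *
      pderiv (fun θ' => fnet L w θ' x₂ i₂) θ l a b

/-- The pseudo-NTK ("sum of logits"): the scalar kernel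
`⟨∇_θ (1/√O) ∑ᵢ f^{(i)}_θ(x₁), ∇_θ (1/√O) ∑ᵢ f^{(i)}_θ(x₂)⟩`. -/
def pNTK (L : ℕ) (w : ℕ → ℕ) (θ : Params L w) (x₁ x₂ : Fin (w 0) → ℝ) : ℝ :=
  ∑ l : Fin L, ∑ a : Fin (w (l.val + 1)), ∑ b : Fin (w l.val),
    pderiv (fun θ' => (Real.sqrt (w L))⁻¹ * ∑ i, fnet L w θ' x₁ i) θ l a b *
      pderiv (fun θ' => (Real.sqrt (w L))⁻¹ * ∑ i, fnet L w θ' x₂ i) θ l a b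

/-- He ("fan-in") initialization: all weights independent, `W^{(l)}_{ij} ~ N(0, 1/n_{l-1})`. -/
def initMeasure (L : ℕ) (w : ℕ → ℕ) : Measure (Params L w) :=
  Measure.pi fun l => Measure.pi fun _ => Measure.pi fun _ =>
    gaussianReal 0 ((w l.val : NNReal))⁻¹

/-- Widths of the ReLU-MLP: input dimension `D`, hidden layers of width `n`, output `O`. -/
def widths (D n O L : ℕ) : ℕ → ℕ
  | 0 => D
  | l + 1 => if l + 1 < L then n else O

/-- Frobenius norm of a real matrix. -/
def frobNorm {m k : Type*} [Fintype m] [Fintype k] (M : Matrix m k ℝ) : ℝ :=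
  Real.sqrt (∑ i, ∑ j, (M i j) ^ 2)


/-- Empirical NTK of the depth-`l` sub-network (post-activations at layer `l`), the
layerwise sum of gradient inner products. -/
def hiddenNTK (L : ℕ) (w : ℕ → ℕ) (l : ℕ) (θ : Params L w) (x₁ x₂ : Fin (w 0) → ℝ) :
    Matrix (Fin (w l)) (Fin (w l)) ℝ := fun i₁ i₂ =>
  ∑ m : Fin L, ∑ a : Fin (w (m.val + 1)), ∑ b : Fin (w m.val),
    pderiv (fun θ' => layerOut w (extParams θ') l x₁ i₁) θ m a b *
      pderiv (fun θ' => layerOut w (extParams θ') l x₂ i₂) θ m a b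

open Function

section Resampling

/-- Integrating over a product probability space is unchanged by resampling one coordinate. -/
lemma lintegral_pi_update {ι : Type*} [Fintype ι] [DecidableEq ι] {X : ι → Type*}
    [∀ i, MeasurableSpace (X i)] (μ : (i : ι) → Measure (X i)) [∀ i, IsProbabilityMeasure (μ i)]
    {f : (∀ i, X i) → ENNReal} (hf : Measurable f) (i : ι) :
    ∫⁻ x, f x ∂Measure.pi μ = ∫⁻ x, ∫⁻ y, f (update x i y) ∂μ i ∂Measure.pi μ := by
  classical
  rcases isEmpty_or_nonempty (∀ i, X i) with he | ⟨⟨x⟩⟩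
  · simp
  have hg : Measurable fun x => ∫⁻ y, f (update x i y) ∂μ i :=
    Measurable.lintegral_prod_right' (f := fun p : (∀ i, X i) × X i => f (update p.1 i p.2))
      (hf.comp measurable_update')
  rw [lintegral_eq_lmarginal_univ x, lintegral_eq_lmarginal_univ x,
    lmarginal_erase' _ hf (Finset.mem_univ i), lmarginal_erase' _ hg (Finset.mem_univ i)]
  simp

/-- A measurable set is null under a product probability measure if almost all of its sections
along one coordinate are null. -/
lemma measure_pi_eq_zero_of_update {ι : Type*} [Fintype ι] [DecidableEq ι] {X : ι → Type*}
    [∀ i, MeasurableSpace (X i)] (μ : (i : ι) → Measure (X i)) [∀ i, IsProbabilityMeasure (μ i)]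
    {s : Set (∀ i, X i)} (hs : MeasurableSet s) (i : ι)
    (h : ∀ x, μ i {y | update x i y ∈ s} = 0) : Measure.pi μ s = 0 := by
  rw [← lintegral_indicator_one hs,
    lintegral_pi_update μ (measurable_one.indicator hs) i]
  refine (lintegral_congr fun x => ?_).trans lintegral_zero
  rw [← h x]
  exact lintegral_indicator_one (measurable_update x (a := i) hs)

end Resampling

section Gaussian

/-- The fourth moment of the standard Gaussian. -/
def gaussFourth : ℝ := ∫ x, x ^ 4 ∂gaussianReal 0 1

lemma gaussFourth_nonneg : 0 ≤ gaussFourth := integral_nonneg fun x => by positivity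

lemma integrable_pow_four_gaussianReal (v : NNReal) :
    Integrable (fun x : ℝ => x ^ 4) (gaussianReal 0 v) := by
  have h := (memLp_id_gaussianReal (μ := 0) (v := v) 4).integrable_norm_pow (p := 4) (by norm_num)
  refine h.congr (Filter.Eventually.of_forall fun x => ?_)
  simp [Even.pow_abs (by decide : Even 4)]

lemma integral_pow_four_gaussianReal (v : NNReal) :
    ∫ x, x ^ 4 ∂gaussianReal 0 v = (v : ℝ) ^ 2 * gaussFourth := by
  have h : gaussianReal 0 v = (gaussianReal 0 1).map (Real.sqrt v * ·) := by
    rw [gaussianReal_map_const_mul]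
    congr 1
    · simp
    · ext; simp
  rw [h, integral_map (by fun_prop) (by fun_prop)]
  simp_rw [mul_pow]
  rw [integral_const_mul, gaussFourth]
  congr 1
  rw [show √(v : ℝ) ^ 4 = (√(v : ℝ) ^ 2) ^ 2 by ring, Real.sq_sqrt v.coe_nonneg]

/-- The bilinear form of a coefficient matrix `K` in two rows of `W`. -/
def rowForm {ι κ : Type*} [Fintype κ] (K : κ → κ → ℝ) (W : ι → κ → ℝ) (i j : ι) : ℝ :=
  ∑ a, ∑ b, W i a * W j b * K a b

lemma rowForm_sq {ι κ : Type*} [Fintype κ] (K : κ → κ → ℝ) (W : ι → κ → ℝ) (i j : ι) :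
    rowForm K W i j ^ 2 = ∑ a, ∑ b, ∑ c, ∑ d,
      K a b * K c d * (W i a * W j b * W i c * W j d) := by
  rw [sq, rowForm, Finset.sum_mul]
  simp_rw [Finset.sum_mul, Finset.mul_sum]
  refine Finset.sum_congr rfl fun a _ => Finset.sum_congr rfl fun b _ =>
    Finset.sum_congr rfl fun c _ => Finset.sum_congr rfl fun d _ => ?_
  ring

variable {ι κ : Type*} [Fintype ι] [Fintype κ]

/-- The law of a matrix with independent `N(0, v)` entries. -/
abbrev gaussMatrix (ι κ : Type*) [Fintype ι] [Fintype κ] (v : NNReal) : Measure (ι → κ → ℝ) :=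
  Measure.pi fun _ => Measure.pi fun _ => gaussianReal 0 v

lemma measurePreserving_entry (v : NNReal) (i : ι) (a : κ) :
    MeasurePreserving (fun W : ι → κ → ℝ => W i a) (gaussMatrix ι κ v) (gaussianReal 0 v) :=
  (measurePreserving_eval (fun _ : κ => gaussianReal 0 v) a).comp
    (measurePreserving_eval (fun _ : ι => Measure.pi fun _ : κ => gaussianReal 0 v) i)

lemma integrable_entry_pow_four (v : NNReal) (α : ι × κ) :
    Integrable (fun W : ι → κ → ℝ => W α.1 α.2 ^ 4) (gaussMatrix ι κ v) :=
  (measurePreserving_entry v α.1 α.2).integrable_comp_of_integrable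
    (integrable_pow_four_gaussianReal v)

lemma integral_entry_pow_four (v : NNReal) (α : ι × κ) :
    ∫ W, W α.1 α.2 ^ 4 ∂gaussMatrix ι κ v = (v : ℝ) ^ 2 * gaussFourth := by
  rw [← integral_pow_four_gaussianReal, ← (measurePreserving_entry v α.1 α.2).map_eq,
    integral_map (measurePreserving_entry v α.1 α.2).aemeasurable (by fun_prop)]

lemma abs_mul_four_le (x y z t : ℝ) :
    |x * y * z * t| ≤ (x ^ 4 + y ^ 4 + z ^ 4 + t ^ 4) / 4 := by
  rw [abs_le]
  constructor <;>
    nlinarith [sq_nonneg (x * y + z * t), sq_nonneg (x * y - z * t), sq_nonneg (x ^ 2 - y ^ 2),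
      sq_nonneg (z ^ 2 - t ^ 2)]

lemma integrable_entry_mul_four (v : NNReal) (α β γ δ : ι × κ) :
    Integrable (fun W : ι → κ → ℝ => W α.1 α.2 * W β.1 β.2 * W γ.1 γ.2 * W δ.1 δ.2)
      (gaussMatrix ι κ v) := by
  refine Integrable.mono' (((((integrable_entry_pow_four v α).add
    (integrable_entry_pow_four v β)).add (integrable_entry_pow_four v γ)).add
    (integrable_entry_pow_four v δ)).div_const 4) (by fun_prop) ?_
  exact Filter.Eventually.of_forall fun W => abs_mul_four_le _ _ _ _

lemma abs_integral_entry_mul_four_le (v : NNReal) (α β γ δ : ι × κ) :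
    |∫ W, W α.1 α.2 * W β.1 β.2 * W γ.1 γ.2 * W δ.1 δ.2 ∂gaussMatrix ι κ v| ≤
      (v : ℝ) ^ 2 * gaussFourth := by
  have hα := integrable_entry_pow_four v α
  have hβ := integrable_entry_pow_four v β
  have hγ := integrable_entry_pow_four v γ
  have hδ := integrable_entry_pow_four v δ
  refine abs_integral_le_integral_abs.trans ((integral_mono
    (integrable_entry_mul_four v α β γ δ).abs ((((hα.add hβ).add hγ).add hδ).div_const 4)
    fun W => abs_mul_four_le _ _ _ _).trans (le_of_eq ?_))
  rw [integral_div, integral_add' ((hα.add hβ).add hγ) hδ, integral_add' (hα.add hβ) hγ,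
    integral_add' hα hβ]
  simp only [integral_entry_pow_four]
  ring

/-- A fourth-order mixed moment vanishes when one of the entries occurs exactly once. -/
lemma integral_entry_mul_eq_zero (v : NNReal) {α β γ δ : ι × κ} (hβ : β ≠ α) (hγ : γ ≠ α)
    (hδ : δ ≠ α) :
    ∫ W, W α.1 α.2 * W β.1 β.2 * W γ.1 γ.2 * W δ.1 δ.2 ∂gaussMatrix ι κ v = 0 := by
  classical
  let T : (ι → κ → ℝ) → ι → κ → ℝ := fun W i a => if (i, a) = α then -W i a else W i a
  have hT : MeasurePreserving T (gaussMatrix ι κ v) (gaussMatrix ι κ v) := by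
    refine measurePreserving_pi (f := fun i (w : κ → ℝ) a => if (i, a) = α then -w a else w a) _ _
      fun i => ?_
    refine measurePreserving_pi (f := fun a (t : ℝ) => if (i, a) = α then -t else t) _ _ fun a => ?_
    split_ifs
    · exact ⟨by fun_prop, by rw [gaussianReal_map_neg, neg_zero]⟩
    · exact MeasurePreserving.id _
  set g : (ι → κ → ℝ) → ℝ := fun W => W α.1 α.2 * W β.1 β.2 * W γ.1 γ.2 * W δ.1 δ.2 with hg
  have hflip : ∀ W, g (T W) = -g W := fun W => by
    simp only [hg, T, Prod.mk.eta, if_true, if_neg hβ, if_neg hγ, if_neg hδ]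
    ring
  have h : ∫ W, g W ∂gaussMatrix ι κ v = -∫ W, g W ∂gaussMatrix ι κ v := by
    conv_lhs => rw [← hT.map_eq]
    rw [integral_map hT.aemeasurable (by fun_prop), ← integral_neg]
    exact integral_congr_ae (Filter.Eventually.of_forall hflip)
  linarith

/-- Only pairings contribute to the fourth-order mixed moments. -/
lemma abs_integral_entry_mul_four_le_ite [DecidableEq ι] [DecidableEq κ] (v : NNReal)
    (i j : ι) (a b c d : κ) :
    |∫ W, W i a * W j b * W i c * W j d ∂gaussMatrix ι κ v| ≤
      (v : ℝ) ^ 2 * gaussFourth * ((if a = b then if c = d then if i = j then 1 else 0 else 0 else 0)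
        + (if a = c then if b = d then 1 else 0 else 0)
        + (if a = d then if b = c then if i = j then 1 else 0 else 0 else 0)) := by
  have h0 : 0 ≤ (v : ℝ) ^ 2 * gaussFourth := mul_nonneg (sq_nonneg _) gaussFourth_nonneg
  have hb := abs_integral_entry_mul_four_le v (i, a) (j, b) (i, c) (j, d)
  by_cases hp : ((i, a) = (j, b) ∧ (i, c) = (j, d)) ∨ ((i, a) = (i, c) ∧ (j, b) = (j, d)) ∨
      ((i, a) = (j, d) ∧ (j, b) = (i, c))
  · refine hb.trans (le_mul_of_one_le_right h0 ?_)
    rcases hp with ⟨h1, h2⟩ | ⟨h1, h2⟩ | ⟨h1, h2⟩ <;> simp only [Prod.mk.injEq] at h1 h2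
    · rw [if_pos h1.2, if_pos h2.2, if_pos h1.1]
      split_ifs <;> norm_num
    · rw [if_pos h1.2, if_pos h2.2]
      split_ifs <;> norm_num
    · rw [if_pos h1.2, if_pos h2.2, if_pos h1.1]
      split_ifs <;> norm_num
  · have hz : ∫ W, W i a * W j b * W i c * W j d ∂gaussMatrix ι κ v = 0 := by
      by_cases h1 : (j, b) ≠ (i, a) ∧ (i, c) ≠ (i, a) ∧ (j, d) ≠ (i, a)
      · exact integral_entry_mul_eq_zero v h1.1 h1.2.1 h1.2.2
      by_cases h2 : (i, a) ≠ (j, b) ∧ (i, c) ≠ (j, b) ∧ (j, d) ≠ (j, b)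
      · rw [← integral_entry_mul_eq_zero v h2.1 h2.2.1 h2.2.2]
        exact integral_congr_ae (Filter.Eventually.of_forall fun W => by simp only; ring)
      by_cases h3 : (i, a) ≠ (i, c) ∧ (j, b) ≠ (i, c) ∧ (j, d) ≠ (i, c)
      · rw [← integral_entry_mul_eq_zero v h3.1 h3.2.1 h3.2.2]
        exact integral_congr_ae (Filter.Eventually.of_forall fun W => by simp only; ring)
      have h4 : (i, a) ≠ (j, d) ∧ (j, b) ≠ (j, d) ∧ (i, c) ≠ (j, d) := by grind
      rw [← integral_entry_mul_eq_zero v h4.1 h4.2.1 h4.2.2]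
      exact integral_congr_ae (Filter.Eventually.of_forall fun W => by simp only; ring)
    rw [hz, abs_zero]
    refine mul_nonneg h0 ?_
    split_ifs <;> norm_num

lemma integrable_rowForm_sq (v : NNReal) (K : κ → κ → ℝ) (i j : ι) :
    Integrable (fun W => rowForm K W i j ^ 2) (gaussMatrix ι κ v) := by
  simp_rw [rowForm_sq]
  exact integrable_finsetSum _ fun a _ => integrable_finsetSum _ fun b _ =>
    integrable_finsetSum _ fun c _ => integrable_finsetSum _ fun d _ =>
      (integrable_entry_mul_four v (i, a) (j, b) (i, c) (j, d)).const_mul _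

lemma integral_rowForm_sq_le [DecidableEq ι] (v : NNReal) (K : κ → κ → ℝ) (i j : ι) :
    ∫ W, rowForm K W i j ^ 2 ∂gaussMatrix ι κ v ≤ (v : ℝ) ^ 2 * gaussFourth *
      ((if i = j then (∑ a, |K a a|) ^ 2 else 0) + 2 * ∑ a, ∑ b, K a b ^ 2) := by
  classical
  have h0 : 0 ≤ (v : ℝ) ^ 2 * gaussFourth := mul_nonneg (sq_nonneg _) gaussFourth_nonneg
  have hI : ∀ a b c d, Integrable (fun W : ι → κ → ℝ =>
      K a b * K c d * (W i a * W j b * W i c * W j d)) (gaussMatrix ι κ v) :=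
    fun a b c d => (integrable_entry_mul_four v (i, a) (j, b) (i, c) (j, d)).const_mul _
  have hexp : ∫ W, rowForm K W i j ^ 2 ∂gaussMatrix ι κ v = ∑ a, ∑ b, ∑ c, ∑ d,
      K a b * K c d * ∫ W, W i a * W j b * W i c * W j d ∂gaussMatrix ι κ v := by
    simp_rw [rowForm_sq]
    rw [integral_finsetSum _ fun a _ => integrable_finsetSum _ fun b _ =>
      integrable_finsetSum _ fun c _ => integrable_finsetSum _ fun d _ => hI a b c d]
    refine Finset.sum_congr rfl fun a _ => ?_
    rw [integral_finsetSum _ fun b _ =>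
      integrable_finsetSum _ fun c _ => integrable_finsetSum _ fun d _ => hI a b c d]
    refine Finset.sum_congr rfl fun b _ => ?_
    rw [integral_finsetSum _ fun c _ => integrable_finsetSum _ fun d _ => hI a b c d]
    refine Finset.sum_congr rfl fun c _ => ?_
    rw [integral_finsetSum _ fun d _ => hI a b c d]
    exact Finset.sum_congr rfl fun d _ => integral_const_mul _ _
  have hterm : ∀ a b c d,
      K a b * K c d * ∫ W, W i a * W j b * W i c * W j d ∂gaussMatrix ι κ v ≤
      (v : ℝ) ^ 2 * gaussFourth *
        ((if a = b then if c = d then if i = j then |K a b| * |K c d| else 0 else 0 else 0)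
        + (if a = c then if b = d then |K a b| * |K c d| else 0 else 0)
        + (if a = d then if b = c then if i = j then |K a b| * |K c d| else 0 else 0 else 0)) := by
    intro a b c d
    refine (le_abs_self _).trans ?_
    rw [abs_mul, abs_mul]
    refine (mul_le_mul_of_nonneg_left (abs_integral_entry_mul_four_le_ite v i j a b c d)
      (by positivity)).trans (le_of_eq ?_)
    split_ifs <;> ring
  have htr : ∑ a, ∑ b, |K a b| * |K b a| ≤ ∑ a, ∑ b, K a b ^ 2 := by
    have h1 : ∑ a, ∑ b, |K a b| * |K b a| ≤ ∑ a, ∑ b, (K a b ^ 2 + K b a ^ 2) / 2 :=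
      Finset.sum_le_sum fun a _ => Finset.sum_le_sum fun b _ => by
        nlinarith [sq_nonneg (|K a b| - |K b a|), sq_abs (K a b), sq_abs (K b a)]
    have h2 : ∑ a, ∑ b, K b a ^ 2 = ∑ a, ∑ b, K a b ^ 2 := Finset.sum_comm
    simp_rw [← Finset.sum_div, Finset.sum_add_distrib] at h1
    linarith
  rw [hexp]
  refine (Finset.sum_le_sum fun a _ => Finset.sum_le_sum fun b _ => Finset.sum_le_sum fun c _ =>
    Finset.sum_le_sum fun d _ => hterm a b c d).trans ?_
  simp_rw [← Finset.mul_sum]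
  refine mul_le_mul_of_nonneg_left ?_ h0
  simp_rw [Finset.sum_add_distrib]
  have e2 : ∑ a, ∑ b, ∑ c, ∑ d, (if a = c then if b = d then |K a b| * |K c d| else 0 else 0)
      = ∑ a, ∑ b, K a b ^ 2 := by
    simp [← sq]
  have e1 : ∑ a, ∑ b, ∑ c, ∑ d,
      (if a = b then if c = d then if i = j then |K a b| * |K c d| else 0 else 0 else 0)
      = if i = j then (∑ a, |K a a|) ^ 2 else 0 := by
    split_ifs <;> simp [sq, Finset.sum_mul_sum]
  have e3 : ∑ a, ∑ b, ∑ c, ∑ d,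
      (if a = d then if b = c then if i = j then |K a b| * |K c d| else 0 else 0 else 0)
      ≤ ∑ a, ∑ b, K a b ^ 2 := by
    split_ifs
    · simpa using htr
    · simp; positivity
  rw [e1, e2]
  linarith

end Gaussian

section GaussianBounds

variable {ι κ : Type*} [Fintype ι] [Fintype κ]

lemma lintegral_sum_rowForm_sq_le (v : NNReal) (K : κ → κ → ℝ) :
    ∫⁻ W, ENNReal.ofReal (∑ i, ∑ j, rowForm K W i j ^ 2) ∂gaussMatrix ι κ v ≤
      ENNReal.ofReal ((v : ℝ) ^ 2 * gaussFourth *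
        (2 * Fintype.card ι ^ 2 + Fintype.card ι * Fintype.card κ) * ∑ a, ∑ b, K a b ^ 2) := by
  classical
  have hI : Integrable (fun W => ∑ i, ∑ j, rowForm K W i j ^ 2) (gaussMatrix ι κ v) :=
    integrable_finsetSum _ fun i _ => integrable_finsetSum _ fun j _ =>
      integrable_rowForm_sq v K i j
  rw [← ofReal_integral_eq_lintegral_ofReal hI
    (Filter.Eventually.of_forall fun W => by positivity)]
  refine ENNReal.ofReal_le_ofReal ?_
  rw [integral_finsetSum _ fun i _ => integrable_finsetSum _ fun j _ =>
    integrable_rowForm_sq v K i j]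
  simp_rw [integral_finsetSum Finset.univ fun j _ => integrable_rowForm_sq v K _ j]
  refine (Finset.sum_le_sum fun i _ => Finset.sum_le_sum fun j _ =>
    integral_rowForm_sq_le v K i j).trans ?_
  have htr : (∑ a, |K a a|) ^ 2 ≤ Fintype.card κ * ∑ a, ∑ b, K a b ^ 2 := by
    refine (sq_sum_le_card_mul_sum_sq).trans ?_
    refine mul_le_mul_of_nonneg_left (Finset.sum_le_sum fun a _ => ?_) (Nat.cast_nonneg _)
    rw [sq_abs]
    exact Finset.single_le_sum (f := fun b => K a b ^ 2) (fun b _ => sq_nonneg _)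
      (Finset.mem_univ a)
  simp_rw [← Finset.mul_sum, Finset.sum_add_distrib, Finset.sum_ite_eq, Finset.mem_univ, if_true,
    Finset.sum_const, Finset.card_univ, nsmul_eq_mul]
  rw [mul_assoc ((v : ℝ) ^ 2 * gaussFourth)]
  refine mul_le_mul_of_nonneg_left ?_ (mul_nonneg (sq_nonneg _) gaussFourth_nonneg)
  have := mul_le_mul_of_nonneg_left htr (Nat.cast_nonneg (α := ℝ) (Fintype.card ι))
  linarith

lemma lintegral_sq_sum_sq_mulVec_le (v : NNReal) (y : κ → ℝ) :
    ∫⁻ W, ENNReal.ofReal ((∑ i, (∑ j, W i j * y j) ^ 2) ^ 2) ∂gaussMatrix ι κ v ≤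
      ENNReal.ofReal ((v : ℝ) ^ 2 * gaussFourth * (3 * Fintype.card ι ^ 2) *
        (∑ j, y j ^ 2) ^ 2) := by
  classical
  set K : κ → κ → ℝ := fun a b => y a * y b with hK
  have hrow : ∀ (W : ι → κ → ℝ) i, rowForm K W i i = (∑ j, W i j * y j) ^ 2 := fun W i => by
    rw [rowForm, sq, Finset.sum_mul_sum]
    exact Finset.sum_congr rfl fun a _ => Finset.sum_congr rfl fun b _ => by rw [hK]; ring
  have htr : ∑ a, |K a a| = ∑ j, y j ^ 2 :=
    Finset.sum_congr rfl fun a _ => by rw [hK]; simp [sq]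
  have hfr : ∑ a, ∑ b, K a b ^ 2 = (∑ j, y j ^ 2) ^ 2 := by
    rw [sq (∑ j, y j ^ 2), Finset.sum_mul_sum]
    exact Finset.sum_congr rfl fun a _ => Finset.sum_congr rfl fun b _ => by rw [hK]; ring
  have hI : Integrable (fun W => (Fintype.card ι : ℝ) * ∑ i, rowForm K W i i ^ 2)
      (gaussMatrix ι κ v) :=
    (integrable_finsetSum _ fun i _ => integrable_rowForm_sq v K i i).const_mul _
  calc _ ≤ ∫⁻ W, ENNReal.ofReal ((Fintype.card ι : ℝ) * ∑ i, rowForm K W i i ^ 2)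
        ∂gaussMatrix ι κ v := lintegral_mono fun W => ENNReal.ofReal_le_ofReal (by
          simp_rw [hrow]; exact sq_sum_le_card_mul_sum_sq)
    _ = ENNReal.ofReal (∫ W, (Fintype.card ι : ℝ) * ∑ i, rowForm K W i i ^ 2
        ∂gaussMatrix ι κ v) := (ofReal_integral_eq_lintegral_ofReal hI
          (Filter.Eventually.of_forall fun W => by positivity)).symm
    _ ≤ _ := by
      refine ENNReal.ofReal_le_ofReal ?_
      rw [integral_const_mul, integral_finsetSum _ fun i _ => integrable_rowForm_sq v K i i]
      refine (mul_le_mul_of_nonneg_left (Finset.sum_le_sum fun i _ =>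
        integral_rowForm_sq_le v K i i) (Nat.cast_nonneg _)).trans (le_of_eq ?_)
      simp only [if_true, htr, hfr, Finset.sum_const, Finset.card_univ, nsmul_eq_mul]
      ring

/-- A nonzero linear form in a row of a Gaussian matrix is almost surely nonzero. -/
lemma gaussMatrix_mulVec_eq_zero {v : NNReal} (hv : v ≠ 0) {y : κ → ℝ} (hy : y ≠ 0) (i : ι) :
    gaussMatrix ι κ v {W | ∑ j, W i j * y j = 0} = 0 := by
  classical
  obtain ⟨a, ha⟩ := Function.ne_iff.mp hy
  have hrow : (Measure.pi fun _ : κ => gaussianReal 0 v) {u | ∑ j, u j * y j = 0} = 0 := by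
    refine measure_pi_eq_zero_of_update _
      (measurableSet_eq_fun (by fun_prop) measurable_const) a fun u => ?_
    have := nullSingletonClass_gaussianReal (μ := 0) hv
    refine measure_mono_null (t := {-(∑ j ∈ Finset.univ.erase a, u j * y j) / y a}) ?_
      (measure_singleton _)
    intro t ht
    have ht' : ∑ j, update u a t j * y j = 0 := ht
    rw [← Finset.add_sum_erase _ _ (Finset.mem_univ a), update_self,
      Finset.sum_congr rfl fun j hj => by rw [update_of_ne (Finset.ne_of_mem_erase hj)]] at ht'
    rw [Set.mem_singleton_iff, eq_div_iff ha]
    linarith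
  exact (measurePreserving_eval (fun _ : ι => Measure.pi fun _ : κ => gaussianReal 0 v)
    i).quasiMeasurePreserving.preimage_null hrow

end GaussianBounds

section Network

variable {L : ℕ} {w : ℕ → ℕ}

lemma extParams_of_lt (θ : Params L w) {l : ℕ} (h : l < L) : extParams θ l = θ ⟨l, h⟩ :=
  dif_pos h

/-- The outputs of layer `l` depend only on the weights of the preceding layers. -/
lemma layerOut_update (θ : Params L w) (m : Fin L) (y : Fin (w (m.val + 1)) → Fin (w m.val) → ℝ)
    (x : Fin (w 0) → ℝ) {l : ℕ} (hl : l ≤ m) :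
    layerOut w (extParams (update θ m y)) l x = layerOut w (extParams θ) l x := by
  induction l with
  | zero => rfl
  | succ l ih =>
    have hlm : (⟨l, by omega⟩ : Fin L) ≠ m := fun h => by
      have := congrArg Fin.val h; simp only at this; omega
    funext i
    simp only [layerOut]
    rw [ih (by omega), extParams_of_lt _ (by omega : l < L), extParams_of_lt _ (by omega : l < L),
      update_of_ne hlm]

lemma continuous_extParams_apply (l : ℕ) (i : Fin (w (l + 1))) (j : Fin (w l)) :
    Continuous fun θ : Params L w => extParams θ l i j := by
  by_cases h : l < L
  · simp only [extParams_of_lt _ h]; fun_prop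
  · simp only [extParams, dif_neg h]; exact continuous_const

lemma continuous_layerOut (l : ℕ) (x : Fin (w 0) → ℝ) (i : Fin (w l)) :
    Continuous fun θ : Params L w => layerOut w (extParams θ) l x i := by
  induction l with
  | zero => exact continuous_const
  | succ l ih =>
    exact (continuous_finsetSum _ fun j _ =>
      (continuous_extParams_apply l i j).mul (ih j)).max continuous_const

lemma update_eq_add_single (θ : Params L w) (m : Fin L)
    (y : Fin (w (m.val + 1)) → Fin (w m.val) → ℝ) :
    update θ m y = θ + Pi.single m (y - θ m) := by
  funext m'
  by_cases h : m' = m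
  · subst h; simp
  · simp [h]

lemma layerOut_add_single (θ : Params L w) (m : Fin L)
    (y : Fin (w (m.val + 1)) → Fin (w m.val) → ℝ)
    (x : Fin (w 0) → ℝ) {l : ℕ} (hl : l ≤ m) :
    layerOut w (extParams (θ + Pi.single m y)) l x = layerOut w (extParams θ) l x := by
  rw [← layerOut_update θ m (y + θ m) x hl, update_eq_add_single, add_sub_cancel_right]

lemma pderiv_layerOut_update (θ : Params L w) (m : Fin L)
    (y : Fin (w (m.val + 1)) → Fin (w m.val) → ℝ)
    (x : Fin (w 0) → ℝ) {l : ℕ} (hl : l ≤ m) (j : Fin (w l)) (k : Fin L)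
    (a : Fin (w (k.val + 1))) (b : Fin (w k.val)) :
    pderiv (fun θ' => layerOut w (extParams θ') l x j) (update θ m y) k a b =
      pderiv (fun θ' => layerOut w (extParams θ') l x j) θ k a b := by
  rw [pderiv, pderiv, update_eq_add_single, ← fderiv_comp_add_right]
  simp only [layerOut_add_single _ _ _ _ hl]

lemma hiddenNTK_update (θ : Params L w) (m : Fin L)
    (y : Fin (w (m.val + 1)) → Fin (w m.val) → ℝ)
    (x₁ x₂ : Fin (w 0) → ℝ) {l : ℕ} (hl : l ≤ m) :
    hiddenNTK L w l (update θ m y) x₁ x₂ = hiddenNTK L w l θ x₁ x₂ := by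
  funext i j
  simp only [hiddenNTK, pderiv_layerOut_update θ m y _ hl]

lemma measurable_hiddenNTK (l : ℕ) (x₁ x₂ : Fin (w 0) → ℝ) (i j : Fin (w l)) :
    Measurable fun θ : Params L w => hiddenNTK L w l θ x₁ x₂ i j := by
  unfold hiddenNTK pderiv
  exact Finset.measurable_sum _ fun m _ => Finset.measurable_sum _ fun a _ =>
    Finset.measurable_sum _ fun b _ =>
      (measurable_fderiv_apply_const ℝ _ _).mul (measurable_fderiv_apply_const ℝ _ _)

/-- The derivative of layer `l` in a weight of a layer that it does not depend on vanishes. -/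
lemma pderiv_layerOut_of_le (θ : Params L w) (x : Fin (w 0) → ℝ) {l : ℕ} (j : Fin (w l))
    (m : Fin L) (hl : l ≤ m) (a : Fin (w (m.val + 1))) (b : Fin (w m.val)) :
    pderiv (fun θ' => layerOut w (extParams θ') l x j) θ m a b = 0 := by
  by_cases hd : DifferentiableAt ℝ (fun θ' => layerOut w (extParams θ') l x j) θ
  · rw [pderiv, ← hd.lineDeriv_eq_fderiv, lineDeriv]
    have h : ∀ t : ℝ, layerOut w (extParams
        (θ + t • (Pi.single m (Pi.single a (Pi.single b (1 : ℝ))) : Params L w))) l x =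
          layerOut w (extParams θ) l x := fun t => by
      rw [← Pi.single_smul]
      exact layerOut_add_single θ m _ x hl
    simp [h]
  · rw [pderiv, fderiv_zero_of_not_differentiableAt hd]; rfl

/-- No preactivation sits at the kink of the ReLU, except above a layer that is switched off. -/
def NoKinkAt (θ : Params L w) (x : Fin (w 0) → ℝ) : Prop :=
  ∀ l, l < L → layerOut w (extParams θ) l x ≠ 0 →
    ∀ i, ∑ j, extParams θ l i j * layerOut w (extParams θ) l x j ≠ 0

lemma hasFDerivAt_relu_comp {E : Type*} [NormedAddCommGroup E] [NormedSpace ℝ E] {f : E → ℝ}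
    {f' : E →L[ℝ] ℝ} {e : E} (hf : HasFDerivAt f f' e) (h : f e ≠ 0) :
    HasFDerivAt (fun e' => relu (f e')) ((if 0 < f e then (1 : ℝ) else 0) • f') e := by
  rcases lt_or_gt_of_ne h with h | h
  · rw [if_neg h.le.not_gt, zero_smul]
    refine (hasFDerivAt_const (0 : ℝ) e).congr_of_eventuallyEq ?_
    filter_upwards [hf.continuousAt.eventually_lt_const h] with e' he'
    exact max_eq_right he'.le
  · rw [if_pos h, one_smul]
    refine hf.congr_of_eventuallyEq ?_
    filter_upwards [hf.continuousAt.eventually_const_lt h] with e' he'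
    exact max_eq_left he'.le

/-- The preactivation feeding coordinate `i` of layer `l + 1`. -/
def preact (l : ℕ) (x : Fin (w 0) → ℝ) (i : Fin (w (l + 1))) (θ : Params L w) : ℝ :=
  ∑ j, extParams θ l i j * layerOut w (extParams θ) l x j

/-- The derivative of the ReLU at a preactivation. -/
def gate (l : ℕ) (x : Fin (w 0) → ℝ) (i : Fin (w (l + 1))) (θ : Params L w) : ℝ :=
  if 0 < preact l x i θ then 1 else 0

lemma gate_mul_gate_sq_le_one (l : ℕ) (x₁ x₂ : Fin (w 0) → ℝ) (i j : Fin (w (l + 1)))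
    (θ : Params L w) : (gate l x₁ i θ * gate l x₂ j θ) ^ 2 ≤ 1 := by
  unfold gate; split_ifs <;> norm_num

/-- Evaluation of one weight, as a continuous linear functional on the parameters. -/
def weightCLM (m : Fin L) (i : Fin (w (m.val + 1))) (j : Fin (w m.val)) : Params L w →L[ℝ] ℝ :=
  (ContinuousLinearMap.proj (R := ℝ) (φ := fun _ : Fin (w m.val) => ℝ) j).comp
    ((ContinuousLinearMap.proj (R := ℝ) (φ := fun _ : Fin (w (m.val + 1)) => Fin (w m.val) → ℝ)
      i).comp (ContinuousLinearMap.proj (R := ℝ)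
        (φ := fun m : Fin L => Fin (w (m.val + 1)) → Fin (w m.val) → ℝ) m))

lemma weightCLM_apply (m : Fin L) (i : Fin (w (m.val + 1))) (j : Fin (w m.val))
    (θ : Params L w) : weightCLM m i j θ = θ m i j := rfl

lemma hasFDerivAt_preact {θ : Params L w} {x : Fin (w 0) → ℝ} {l : ℕ} (hl : l < L)
    (hd : ∀ j, DifferentiableAt ℝ (fun θ' : Params L w => layerOut w (extParams θ') l x j) θ)
    (i : Fin (w (l + 1))) :
    HasFDerivAt (preact l x i)
      (∑ j, (θ ⟨l, hl⟩ i j • fderiv ℝ (fun θ' : Params L w => layerOut w (extParams θ') l x j) θ +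
        layerOut w (extParams θ) l x j • weightCLM ⟨l, hl⟩ i j)) θ := by
  unfold preact
  simp only [extParams_of_lt _ hl]
  exact HasFDerivAt.fun_sum fun j _ => (weightCLM ⟨l, hl⟩ i j).hasFDerivAt.mul (hd j).hasFDerivAt

/-- Away from kinks, the layers are differentiable in the parameters, and a layer is either
nonzero or switched off on a neighbourhood. -/
lemma NoKinkAt.layerOut_dichotomy {θ : Params L w} {x : Fin (w 0) → ℝ} (hθ : NoKinkAt θ x)
    {l : ℕ} (hl : l ≤ L) :
    (∀ i, DifferentiableAt ℝ (fun θ' : Params L w => layerOut w (extParams θ') l x i) θ) ∧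
      (layerOut w (extParams θ) l x ≠ 0 ∨
        ∀ᶠ θ' : Params L w in nhds θ, layerOut w (extParams θ') l x = 0) := by
  induction l with
  | zero =>
    refine ⟨fun i => differentiableAt_const _, ?_⟩
    by_cases h : layerOut w (extParams θ) 0 x = 0
    · exact Or.inr (Filter.Eventually.of_forall fun _ => h)
    · exact Or.inl h
  | succ l ih =>
    obtain ⟨hd, h⟩ := ih (by omega)
    have hpre := fun i => hasFDerivAt_preact (x := x) (show l < L by omega) hd i
    rcases h with h | h
    · have hne := hθ l (by omega) h
      refine ⟨fun i => (hasFDerivAt_relu_comp (hpre i) (hne i)).differentiableAt, ?_⟩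
      by_cases hpos : ∃ i, 0 < preact l x i θ
      · obtain ⟨i, hi⟩ := hpos
        exact Or.inl fun h0 => hi.ne' ((max_eq_left hi.le).symm.trans (congrFun h0 i))
      · push Not at hpos
        refine Or.inr ?_
        have : ∀ i, ∀ᶠ θ' in nhds θ, preact l x i θ' < 0 := fun i =>
          (hpre i).continuousAt.eventually_lt_const (lt_of_le_of_ne (hpos i) (hne i))
        filter_upwards [Filter.eventually_all.2 this] with θ' h'
        exact funext fun i => max_eq_right (h' i).le
    · have h0 : ∀ᶠ θ' : Params L w in nhds θ, layerOut w (extParams θ') (l + 1) x = 0 := by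
        filter_upwards [h] with θ' h'
        funext i
        simp [layerOut, h', relu]
      refine ⟨fun i => (differentiableAt_const (0 : ℝ)).congr_of_eventuallyEq ?_, Or.inr h0⟩
      filter_upwards [h0] with θ' h'
      rw [h', Pi.zero_apply]

lemma NoKinkAt.hasFDerivAt_layerOut_succ {θ : Params L w} {x : Fin (w 0) → ℝ}
    (hθ : NoKinkAt θ x) {l : ℕ} (hl : l < L) (i : Fin (w (l + 1))) :
    HasFDerivAt (fun θ' : Params L w => layerOut w (extParams θ') (l + 1) x i)
      (gate l x i θ •
        ∑ j, (θ ⟨l, hl⟩ i j • fderiv ℝ (fun θ' : Params L w => layerOut w (extParams θ') l x j) θ +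
          layerOut w (extParams θ) l x j • weightCLM ⟨l, hl⟩ i j)) θ := by
  obtain ⟨hd, h⟩ := hθ.layerOut_dichotomy hl.le
  rcases h with h | h
  · exact hasFDerivAt_relu_comp (hasFDerivAt_preact hl hd i) (hθ l hl h i)
  · have : preact l x i θ = 0 := by simp [preact, h.self_of_nhds]
    rw [gate, this, if_neg (lt_irrefl _), zero_smul]
    refine (hasFDerivAt_const (0 : ℝ) θ).congr_of_eventuallyEq ?_
    filter_upwards [h] with θ' h'
    simp [layerOut, h', relu]

lemma NoKinkAt.pderiv_layerOut_succ {θ : Params L w} {x : Fin (w 0) → ℝ}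
    (hθ : NoKinkAt θ x) {l : ℕ} (hl : l < L) (i : Fin (w (l + 1))) (m : Fin L)
    (a : Fin (w (m.val + 1))) (b : Fin (w m.val)) :
    pderiv (fun θ' : Params L w => layerOut w (extParams θ') (l + 1) x i) θ m a b =
      gate l x i θ *
        (∑ j, θ ⟨l, hl⟩ i j * pderiv (fun θ' => layerOut w (extParams θ') l x j) θ m a b +
        ∑ j, layerOut w (extParams θ) l x j *
          weightCLM ⟨l, hl⟩ i j (Pi.single m (Pi.single a (Pi.single b 1)))) := by
  rw [pderiv, (hθ.hasFDerivAt_layerOut_succ hl i).fderiv, ← Finset.sum_add_distrib]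
  simp [pderiv]

lemma sum_mul_sum_eq_rowForm {P ι κ : Type*} [Fintype P] [Fintype κ] (W : ι → κ → ℝ)
    (u u' : κ → P → ℝ) (i i' : ι) :
    ∑ p, (∑ j, W i j * u j p) * ∑ j, W i' j * u' j p =
      rowForm (fun j j' => ∑ p, u j p * u' j' p) W i i' := by
  simp_rw [rowForm, Finset.sum_mul_sum, Finset.mul_sum]
  rw [Finset.sum_comm]
  refine Finset.sum_congr rfl fun j _ => ?_
  rw [Finset.sum_comm]
  exact Finset.sum_congr rfl fun j' _ => Finset.sum_congr rfl fun p _ => by ring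

/-- The index set of the weights. -/
abbrev WeightIndex (L : ℕ) (w : ℕ → ℕ) : Type :=
  Σ m : Fin L, Fin (w (m.val + 1)) × Fin (w m.val)

/-- The recursion for the empirical NTK of the hidden layers. -/
lemma hiddenNTK_succ {θ : Params L w} {x₁ x₂ : Fin (w 0) → ℝ}
    (h₁ : NoKinkAt θ x₁) (h₂ : NoKinkAt θ x₂) {l : ℕ} (hl : l < L) (i₁ i₂ : Fin (w (l + 1))) :
    hiddenNTK L w (l + 1) θ x₁ x₂ i₁ i₂ = gate l x₁ i₁ θ * gate l x₂ i₂ θ *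
      (rowForm (hiddenNTK L w l θ x₁ x₂) (θ ⟨l, hl⟩) i₁ i₂ +
        if i₁ = i₂ then
          ∑ j, layerOut w (extParams θ) l x₁ j * layerOut w (extParams θ) l x₂ j else 0) := by
  set u : (Fin (w 0) → ℝ) → Fin (w l) → WeightIndex L w → ℝ := fun x j p =>
    pderiv (fun θ' => layerOut w (extParams θ') l x j) θ p.1 p.2.1 p.2.2 with hu
  set e : (Fin (w 0) → ℝ) → Fin (w (l + 1)) → WeightIndex L w → ℝ := fun x i p =>
    ∑ j, layerOut w (extParams θ) l x j *
      weightCLM ⟨l, hl⟩ i j (Pi.single p.1 (Pi.single p.2.1 (Pi.single p.2.2 1))) with he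
  have hK : hiddenNTK L w l θ x₁ x₂ = fun j j' => ∑ p, u x₁ j p * u x₂ j' p := by
    funext j j'
    simp only [hiddenNTK, hu, Fintype.sum_sigma, Fintype.sum_prod_type]
  have hsame : ∀ x i (a : Fin (w (l + 1))) (b : Fin (w l)),
      e x i ⟨⟨l, hl⟩, a, b⟩ = if i = a then layerOut w (extParams θ) l x b else 0 := by
    intro x i a b
    simp only [he, weightCLM_apply, Pi.single_eq_same]
    by_cases h : i = a
    · subst h; simp [Pi.single_apply]
    · simp [h]
  have hother : ∀ x i (p : WeightIndex L w), p.1 ≠ ⟨l, hl⟩ → e x i p = 0 := by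
    intro x i p hp
    simp [he, weightCLM_apply, Pi.single_eq_of_ne hp.symm]
  have hu0 : ∀ x j (p : WeightIndex L w), p.1 = ⟨l, hl⟩ → u x j p = 0 := by
    intro x j p hp
    exact pderiv_layerOut_of_le θ x j _ (by rw [hp]) _ _
  have hcross : ∀ x x' i i' (p : WeightIndex L w),
      (∑ j, θ ⟨l, hl⟩ i j * u x j p) * e x' i' p = 0 := by
    intro x x' i i' p
    by_cases hp : p.1 = ⟨l, hl⟩
    · simp [hu0 _ _ p hp]
    · simp [hother _ _ p hp]
  have hee : ∑ p, e x₁ i₁ p * e x₂ i₂ p = if i₁ = i₂ then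
      ∑ j, layerOut w (extParams θ) l x₁ j * layerOut w (extParams θ) l x₂ j else 0 := by
    rw [Fintype.sum_sigma, Fintype.sum_eq_single (⟨l, hl⟩ : Fin L) fun m hm =>
      Finset.sum_eq_zero fun q _ => by rw [hother _ _ ⟨m, q⟩ hm, zero_mul],
      Fintype.sum_prod_type]
    simp only [hsame]
    by_cases h : i₁ = i₂
    · subst h
      rw [Fintype.sum_eq_single i₁ fun a ha => by simp [ha.symm]]
      simp
    · rw [if_neg h]
      refine Finset.sum_eq_zero fun a _ => Finset.sum_eq_zero fun b _ => ?_
      by_cases ha : i₁ = a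
      · simp [show i₂ ≠ a from fun h' => h (ha.trans h'.symm)]
      · simp [ha]
  have hsucc : hiddenNTK L w (l + 1) θ x₁ x₂ i₁ i₂ = ∑ p,
      (gate l x₁ i₁ θ * (∑ j, θ ⟨l, hl⟩ i₁ j * u x₁ j p + e x₁ i₁ p)) *
        (gate l x₂ i₂ θ * (∑ j, θ ⟨l, hl⟩ i₂ j * u x₂ j p + e x₂ i₂ p)) := by
    simp only [hiddenNTK, h₁.pderiv_layerOut_succ hl, h₂.pderiv_layerOut_succ hl]
    simp only [hu, he, Fintype.sum_sigma, Fintype.sum_prod_type]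
  rw [hsucc, hK, ← sum_mul_sum_eq_rowForm, ← hee, ← Finset.sum_add_distrib, Finset.mul_sum]
  refine Finset.sum_congr rfl fun p _ => ?_
  linear_combination gate l x₁ i₁ θ * gate l x₂ i₂ θ * (hcross x₁ x₂ i₁ i₂ p) +
    gate l x₁ i₁ θ * gate l x₂ i₂ θ * (hcross x₂ x₁ i₂ i₁ p)

end Network

section Moments

variable {L : ℕ} {w : ℕ → ℕ}

instance (ι κ : Type*) [Fintype ι] [Fintype κ] (v : NNReal) :
    IsProbabilityMeasure (gaussMatrix ι κ v) := by
  unfold gaussMatrix; infer_instance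

instance : IsProbabilityMeasure (initMeasure L w) := by
  unfold initMeasure; infer_instance

lemma initMeasure_eq_pi : initMeasure L w = Measure.pi fun l : Fin L =>
    gaussMatrix (Fin (w (l.val + 1))) (Fin (w l.val)) ((w l.val : NNReal))⁻¹ := rfl

/-- Under the initialization almost no parameter puts a preactivation at the kink. -/
lemma ae_noKinkAt (x : Fin (w 0) → ℝ) : ∀ᵐ θ ∂initMeasure L w, NoKinkAt θ x := by
  have key : ∀ l (_ : l < L) i, initMeasure L w {θ | layerOut w (extParams θ) l x ≠ 0 ∧
      ∑ j, extParams θ l i j * layerOut w (extParams θ) l x j = 0} = 0 := by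
    intro l hl i
    have hf : Measurable fun θ : Params L w => layerOut w (extParams θ) l x :=
      measurable_pi_iff.2 fun j => (continuous_layerOut l x j).measurable
    have hp : Measurable fun θ : Params L w =>
        ∑ j, extParams θ l i j * layerOut w (extParams θ) l x j :=
      (continuous_finsetSum _ fun j _ =>
        (continuous_extParams_apply l i j).mul (continuous_layerOut l x j)).measurable
    rw [initMeasure_eq_pi]
    refine measure_pi_eq_zero_of_update _ ((hf (measurableSet_singleton 0).compl).inter
      (hp (measurableSet_singleton 0))) ⟨l, hl⟩ fun θ => ?_
    simp only [Set.mem_ofPred_eq, layerOut_update θ ⟨l, hl⟩ _ x le_rfl, extParams_of_lt _ hl,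
      update_self]
    by_cases h : layerOut w (extParams θ) l x = 0
    · simp [h]
    · have hw : w l ≠ 0 := fun h0 => h (funext fun j => absurd j.2 (by omega))
      simpa [h] using gaussMatrix_mulVec_eq_zero (ι := Fin (w (l + 1)))
        (inv_ne_zero (Nat.cast_ne_zero.2 hw) : ((w l : NNReal))⁻¹ ≠ 0) h i
  refine ae_all_iff.2 fun l => ae_all_iff.2 fun hl => ?_
  filter_upwards [ae_all_iff.2 fun i => measure_eq_zero_iff_ae_notMem.1 (key l hl i)]
    with θ h h0 i hi using h i ⟨h0, hi⟩

lemma measurable_sq_sum_sq_layerOut (l : ℕ) (x : Fin (w 0) → ℝ) :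
    Measurable fun θ : Params L w =>
      ENNReal.ofReal ((∑ j, layerOut w (extParams θ) l x j ^ 2) ^ 2) :=
  ((continuous_finsetSum _ fun j _ =>
    (continuous_layerOut l x j).pow 2).pow 2).measurable.ennreal_ofReal

lemma relu_sq_le (t : ℝ) : relu t ^ 2 ≤ t ^ 2 := by
  unfold relu
  rcases le_total t 0 with h | h
  · rw [max_eq_right h, zero_pow two_ne_zero]; exact sq_nonneg t
  · rw [max_eq_left h]

lemma lintegral_sq_sum_sq_layerOut_succ_le (x : Fin (w 0) → ℝ) {l : ℕ} (hl : l < L) :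
    ∫⁻ θ, ENNReal.ofReal ((∑ j, layerOut w (extParams θ) (l + 1) x j ^ 2) ^ 2) ∂initMeasure L w ≤
      ENNReal.ofReal (((w l : ℝ)⁻¹) ^ 2 * gaussFourth * (3 * (w (l + 1) : ℝ) ^ 2)) *
        ∫⁻ θ, ENNReal.ofReal ((∑ j, layerOut w (extParams θ) l x j ^ 2) ^ 2)
          ∂initMeasure L w := by
  rw [← lintegral_const_mul _ (measurable_sq_sum_sq_layerOut l x), initMeasure_eq_pi,
    lintegral_pi_update _ (measurable_sq_sum_sq_layerOut (l + 1) x) ⟨l, hl⟩]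
  refine lintegral_mono fun θ => ?_
  have h0 : 0 ≤ ((w l : ℝ)⁻¹) ^ 2 * gaussFourth * (3 * (w (l + 1) : ℝ) ^ 2) :=
    mul_nonneg (mul_nonneg (sq_nonneg _) gaussFourth_nonneg) (by positivity)
  have h := lintegral_sq_sum_sq_mulVec_le (ι := Fin (w (l + 1))) ((w l : NNReal))⁻¹
    (layerOut w (extParams θ) l x)
  simp only [Fintype.card_fin, NNReal.coe_inv, NNReal.coe_natCast] at h
  rw [← ENNReal.ofReal_mul h0]
  refine le_trans (lintegral_mono fun W => ENNReal.ofReal_le_ofReal ?_) h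
  have hW : ∀ i, layerOut w (extParams (update θ ⟨l, hl⟩ W)) (l + 1) x i =
      relu (∑ j, W i j * layerOut w (extParams θ) l x j) := fun i => by
    rw [layerOut, layerOut_update θ ⟨l, hl⟩ W x le_rfl, extParams_of_lt _ hl, update_self]
  simp only [hW]
  exact pow_le_pow_left₀ (Finset.sum_nonneg fun _ _ => sq_nonneg _)
    (Finset.sum_le_sum fun _ _ => relu_sq_le _) 2

/-- The fourth moment of the norm of a layer grows at most like the squared width. -/
lemma lintegral_sq_sum_sq_layerOut_le (hw : ∀ l < L, 0 < w l) (x : Fin (w 0) → ℝ) {l : ℕ}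
    (hl : l < L) :
    ∫⁻ θ, ENNReal.ofReal ((∑ j, layerOut w (extParams θ) l x j ^ 2) ^ 2) ∂initMeasure L w ≤
      ENNReal.ofReal ((3 * gaussFourth) ^ l * (∑ j, x j ^ 2) ^ 2 * (w l : ℝ) ^ 2) := by
  have hc := gaussFourth_nonneg
  induction l with
  | zero =>
    simp only [layerOut, lintegral_const, measure_univ, mul_one, pow_zero, one_mul]
    refine ENNReal.ofReal_le_ofReal (le_mul_of_one_le_right (sq_nonneg _) ?_)
    exact one_le_pow₀ (by exact_mod_cast hw 0 hl)
  | succ l ih =>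
    have h0 : 0 ≤ ((w l : ℝ)⁻¹) ^ 2 * gaussFourth * (3 * (w (l + 1) : ℝ) ^ 2) := by positivity
    have hwl : (w l : ℝ) ≠ 0 := by exact_mod_cast (hw l (by omega)).ne'
    refine (lintegral_sq_sum_sq_layerOut_succ_le x (by omega)).trans
      ((mul_le_mul_right (ih (by omega)) _).trans_eq ?_)
    rw [← ENNReal.ofReal_mul h0]
    congr 1
    field_simp
    ring

lemma measurable_sum_hiddenNTK_sq (l : ℕ) (x₁ x₂ : Fin (w 0) → ℝ) :
    Measurable fun θ : Params L w =>
      ∑ i, ∑ j, hiddenNTK L w l θ x₁ x₂ i j ^ 2 :=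
  Finset.measurable_sum _ fun i _ => Finset.measurable_sum _ fun j _ =>
    (measurable_hiddenNTK l x₁ x₂ i j).pow_const 2

lemma sum_hiddenNTK_succ_sq_le {θ : Params L w} {x₁ x₂ : Fin (w 0) → ℝ}
    (h₁ : NoKinkAt θ x₁) (h₂ : NoKinkAt θ x₂) {l : ℕ} (hl : l < L) :
    ∑ i, ∑ j, hiddenNTK L w (l + 1) θ x₁ x₂ i j ^ 2 ≤
      2 * ∑ i, ∑ j, rowForm (hiddenNTK L w l θ x₁ x₂) (θ ⟨l, hl⟩) i j ^ 2 +
        w (l + 1) * ((∑ j, layerOut w (extParams θ) l x₁ j ^ 2) ^ 2 +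
          (∑ j, layerOut w (extParams θ) l x₂ j ^ 2) ^ 2) := by
  set d := ∑ j, layerOut w (extParams θ) l x₁ j * layerOut w (extParams θ) l x₂ j with hd
  set s₁ := ∑ j, layerOut w (extParams θ) l x₁ j ^ 2
  set s₂ := ∑ j, layerOut w (extParams θ) l x₂ j ^ 2
  have hds : 2 * d ^ 2 ≤ s₁ ^ 2 + s₂ ^ 2 := by
    have : d ^ 2 ≤ s₁ * s₂ := Finset.sum_mul_sq_le_sq_mul_sq _ _ _
    nlinarith [sq_nonneg (s₁ - s₂)]
  have hentry : ∀ i j, hiddenNTK L w (l + 1) θ x₁ x₂ i j ^ 2 ≤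
      2 * rowForm (hiddenNTK L w l θ x₁ x₂) (θ ⟨l, hl⟩) i j ^ 2 +
        if i = j then s₁ ^ 2 + s₂ ^ 2 else 0 := by
    intro i j
    rw [hiddenNTK_succ h₁ h₂ hl, ← hd, mul_pow]
    refine (mul_le_of_le_one_left (sq_nonneg _) (gate_mul_gate_sq_le_one l x₁ x₂ i j θ)).trans ?_
    set r := rowForm (hiddenNTK L w l θ x₁ x₂) (θ ⟨l, hl⟩) i j
    split_ifs
    · nlinarith [sq_nonneg (r - d)]
    · nlinarith [sq_nonneg r]
  refine (Finset.sum_le_sum fun i _ => Finset.sum_le_sum fun j _ => hentry i j).trans_eq ?_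
  simp [Finset.sum_add_distrib, Finset.mul_sum, mul_add]

lemma lintegral_sum_hiddenNTK_succ_sq_le (x₁ x₂ : Fin (w 0) → ℝ) {l : ℕ} (hl : l < L) :
    ∫⁻ θ, ENNReal.ofReal (∑ i, ∑ j, hiddenNTK L w (l + 1) θ x₁ x₂ i j ^ 2) ∂initMeasure L w ≤
      ENNReal.ofReal (2 * (((w l : ℝ)⁻¹) ^ 2 * gaussFourth *
          (2 * (w (l + 1) : ℝ) ^ 2 + w (l + 1) * w l))) *
        ∫⁻ θ, ENNReal.ofReal (∑ i, ∑ j, hiddenNTK L w l θ x₁ x₂ i j ^ 2) ∂initMeasure L w +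
      ENNReal.ofReal (w (l + 1)) *
        (∫⁻ θ, ENNReal.ofReal ((∑ j, layerOut w (extParams θ) l x₁ j ^ 2) ^ 2) ∂initMeasure L w +
        ∫⁻ θ, ENNReal.ofReal ((∑ j, layerOut w (extParams θ) l x₂ j ^ 2) ^ 2)
          ∂initMeasure L w) := by
  have hc := gaussFourth_nonneg
  have hm : Measurable fun θ : Params L w => ENNReal.ofReal
      (∑ i, ∑ j, rowForm (hiddenNTK L w l θ x₁ x₂) (θ ⟨l, hl⟩) i j ^ 2) := by
    refine Measurable.ennreal_ofReal (Finset.measurable_sum _ fun i _ =>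
      Finset.measurable_sum _ fun j _ => Measurable.pow_const ?_ 2)
    unfold rowForm
    have := measurable_hiddenNTK (L := L) (w := w) l x₁ x₂
    fun_prop
  have hpath : ∀ᵐ θ ∂initMeasure L w,
      ENNReal.ofReal (∑ i, ∑ j, hiddenNTK L w (l + 1) θ x₁ x₂ i j ^ 2) ≤
        ENNReal.ofReal 2 * ENNReal.ofReal
          (∑ i, ∑ j, rowForm (hiddenNTK L w l θ x₁ x₂) (θ ⟨l, hl⟩) i j ^ 2) +
        ENNReal.ofReal (w (l + 1)) *
          (ENNReal.ofReal ((∑ j, layerOut w (extParams θ) l x₁ j ^ 2) ^ 2) +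
            ENNReal.ofReal ((∑ j, layerOut w (extParams θ) l x₂ j ^ 2) ^ 2)) := by
    filter_upwards [ae_noKinkAt x₁, ae_noKinkAt x₂] with θ h₁ h₂
    rw [← ENNReal.ofReal_mul (by norm_num), ← ENNReal.ofReal_add (by positivity) (by positivity),
      ← ENNReal.ofReal_mul (by positivity), ← ENNReal.ofReal_add (by positivity) (by positivity)]
    exact ENNReal.ofReal_le_ofReal (sum_hiddenNTK_succ_sq_le h₁ h₂ hl)
  have hrow : ∫⁻ θ, ENNReal.ofReal
      (∑ i, ∑ j, rowForm (hiddenNTK L w l θ x₁ x₂) (θ ⟨l, hl⟩) i j ^ 2) ∂initMeasure L w ≤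
      ENNReal.ofReal (((w l : ℝ)⁻¹) ^ 2 * gaussFourth *
          (2 * (w (l + 1) : ℝ) ^ 2 + w (l + 1) * w l)) *
        ∫⁻ θ, ENNReal.ofReal (∑ i, ∑ j, hiddenNTK L w l θ x₁ x₂ i j ^ 2) ∂initMeasure L w := by
    rw [← lintegral_const_mul _ (measurable_sum_hiddenNTK_sq l x₁ x₂).ennreal_ofReal,
      initMeasure_eq_pi, lintegral_pi_update _ hm ⟨l, hl⟩]
    refine lintegral_mono fun θ => ?_
    rw [← ENNReal.ofReal_mul (by positivity)]
    simp only [hiddenNTK_update θ ⟨l, hl⟩ _ x₁ x₂ le_rfl, update_self]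
    simpa using lintegral_sum_rowForm_sq_le (ι := Fin (w (l + 1))) ((w l : NNReal))⁻¹
      (hiddenNTK L w l θ x₁ x₂)
  have h₁ := measurable_sq_sum_sq_layerOut (L := L) l x₁
  have h₂ := measurable_sq_sum_sq_layerOut (L := L) l x₂
  refine (lintegral_mono_ae hpath).trans ?_
  rw [lintegral_add_left (hm.const_mul _), lintegral_const_mul _ hm,
    lintegral_const_mul' _ _ ENNReal.ofReal_ne_top, lintegral_add_left h₁,
    ENNReal.ofReal_mul (by norm_num), mul_assoc]
  gcongr

end Moments

lemma hiddenNTK_zero {L : ℕ} {w : ℕ → ℕ} (θ : Params L w) (x₁ x₂ : Fin (w 0) → ℝ) :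
    hiddenNTK L w 0 θ x₁ x₂ = 0 := by
  funext i j
  simp [hiddenNTK, pderiv_layerOut_of_le]

/-- The constant in the second moment bound for the hidden empirical NTK of depth `l`, in terms of
the input dimension `d` and the sum `s` of the fourth powers of the norms of the inputs. -/
def ntkMomentConst (d s : ℝ) : ℕ → ℝ
  | 0 => 0
  | l + 1 => 6 * gaussFourth * ntkMomentConst d s l + d ^ 2 * ((3 * gaussFourth) ^ l * s)

lemma ntkMomentConst_nonneg {d s : ℝ} (hs : 0 ≤ s) (l : ℕ) : 0 ≤ ntkMomentConst d s l := by
  have hc := gaussFourth_nonneg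
  induction l with
  | zero => exact le_rfl
  | succ l ih => unfold ntkMomentConst; positivity

/-- The second moment of the Frobenius norm of the hidden empirical NTK is `O(n ^ 3)`. -/
lemma lintegral_sum_hiddenNTK_sq_le {L : ℕ} {w : ℕ → ℕ} {n : ℕ} (hn : 0 < n) (hw₀ : 0 < w 0)
    (hw : ∀ l, l + 1 < L → w (l + 1) = n) (x₁ x₂ : Fin (w 0) → ℝ) {l : ℕ} (hl : l < L) :
    ∫⁻ θ, ENNReal.ofReal (∑ i, ∑ j, hiddenNTK L w l θ x₁ x₂ i j ^ 2) ∂initMeasure L w ≤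
      ENNReal.ofReal (ntkMomentConst (w 0)
        ((∑ j, x₁ j ^ 2) ^ 2 + (∑ j, x₂ j ^ 2) ^ 2) l * (n : ℝ) ^ 3) := by
  have hc := gaussFourth_nonneg
  have hpos : ∀ l < L, 0 < w l := by
    rintro (_ | l) hl
    · exact hw₀
    · rwa [hw l hl]
  induction l with
  | zero => simp only [hiddenNTK_zero]; simp
  | succ l ih =>
    have hK := ntkMomentConst_nonneg (d := w 0)
      (add_nonneg (sq_nonneg (∑ j, x₁ j ^ 2)) (sq_nonneg (∑ j, x₂ j ^ 2))) l
    have hA := fun x => lintegral_sq_sum_sq_layerOut_le hpos x (by omega : l < L)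
    refine (lintegral_sum_hiddenNTK_succ_sq_le x₁ x₂ (by omega)).trans
      ((add_le_add (b := ENNReal.ofReal (6 * gaussFourth * ntkMomentConst (w 0)
        ((∑ j, x₁ j ^ 2) ^ 2 + (∑ j, x₂ j ^ 2) ^ 2) l * (n : ℝ) ^ 3)) ?_
        (mul_le_mul_right (add_le_add (hA x₁) (hA x₂)) _)).trans ?_)
    · rcases l with _ | l
      · simp only [hiddenNTK_zero]; simp
      · refine (mul_le_mul_right (ih (by omega)) _).trans_eq ?_
        rw [← ENNReal.ofReal_mul (by positivity), hw _ hl, hw _ (by omega)]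
        congr 1
        field_simp
        ring
    · have hn1 : (1 : ℝ) ≤ n := by exact_mod_cast hn
      have hwl : (w l : ℝ) ≤ w 0 * n := by
        have hw1 : (1 : ℝ) ≤ w 0 := by exact_mod_cast hw₀
        rcases l with _ | l
        · exact le_mul_of_one_le_right (by positivity) hn1
        · rw [hw _ (by omega)]
          exact le_mul_of_one_le_left (by positivity) hw1
      rw [hw _ hl, ← ENNReal.ofReal_add (by positivity) (by positivity),
        ← ENNReal.ofReal_mul (by positivity),
        ← ENNReal.ofReal_add (by positivity) (by positivity), ntkMomentConst]
      refine ENNReal.ofReal_le_ofReal ?_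
      generalize ntkMomentConst _ _ l = K at *
      calc _ ≤ 6 * gaussFourth * K * (n : ℝ) ^ 3 +
            n * ((3 * gaussFourth) ^ l * (∑ j, x₁ j ^ 2) ^ 2 * (w 0 * n) ^ 2 +
              (3 * gaussFourth) ^ l * (∑ j, x₂ j ^ 2) ^ 2 * (w 0 * n) ^ 2) := by gcongr
        _ = _ := by ring

/-- Chebyshev's inequality for the Frobenius norm of a random matrix. -/
lemma le_measure_frobNorm_le {Ω m k : Type*} [MeasurableSpace Ω] [Fintype m] [Fintype k]
    (μ : Measure Ω) [IsProbabilityMeasure μ] {M : Ω → Matrix m k ℝ}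
    (hM : Measurable fun ω => ∑ i, ∑ j, M ω i j ^ 2) {δ B t : ℝ} (hδ : 0 ≤ δ) (ht : 0 < t)
    (hB : ∫⁻ ω, ENNReal.ofReal (∑ i, ∑ j, M ω i j ^ 2) ∂μ ≤ ENNReal.ofReal B)
    (hBt : B ≤ δ * t ^ 2) :
    ENNReal.ofReal (1 - δ) ≤ μ {ω | frobNorm (M ω) ≤ t} := by
  have hset : MeasurableSet {ω | frobNorm (M ω) ≤ t} :=
    measurableSet_le (Real.continuous_sqrt.measurable.comp hM) measurable_const
  have hsub : {ω | frobNorm (M ω) ≤ t}ᶜ ⊆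
      {ω | ENNReal.ofReal (t ^ 2) ≤ ENNReal.ofReal (∑ i, ∑ j, M ω i j ^ 2)} := by
    intro ω hω
    have hω : t < √(∑ i, ∑ j, M ω i j ^ 2) := not_le.1 hω
    exact ENNReal.ofReal_le_ofReal ((Real.lt_sqrt ht.le).1 hω).le
  have hcompl : μ {ω | frobNorm (M ω) ≤ t}ᶜ ≤ ENNReal.ofReal δ := by
    refine (measure_mono hsub).trans
      ((meas_ge_le_lintegral_div hM.ennreal_ofReal.aemeasurable (by simpa using ht.ne')
        ENNReal.ofReal_ne_top).trans ?_)
    refine ENNReal.div_le_of_le_mul (hB.trans ?_)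
    rw [← ENNReal.ofReal_mul' (by positivity)]
    exact ENNReal.ofReal_le_ofReal hBt
  rw [ENNReal.ofReal_sub _ hδ, ENNReal.ofReal_one, tsub_le_iff_right,
    ← prob_add_prob_compl (μ := μ) hset]
  gcongr

/-- **Bound on the growth of ReLU networks' NTKs.** In the ReLU-MLP setting, for every
`δ > 0` there are `n₀ = O(polylog(L/δ))` and a constant `C` (independent of `n`) such
that for every hidden layer `l ∈ {1, …, L-1}` and all `n > n₀`, with probability at least
`1 - δ` over the random initialization, `‖Θ^(l)(x₁,x₂)‖_F ≤ C n^{3/2}`. -/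
theorem hidden_eNTK_frobenius_growth
    (D O L : ℕ) (hD : 0 < D) (hO : 0 < O) (hL : 2 ≤ L)
    (S : Set (Fin D → ℝ)) (hS : IsCompact S)
    (x₁ x₂ : Fin D → ℝ) (hx₁ : x₁ ∈ S) (hx₂ : x₂ ∈ S) :
    ∃ (k : ℕ) (C₀ : ℝ), 0 < C₀ ∧
      ∀ δ : ℝ, 0 < δ →
        ∃ (n₀ : ℕ) (C : ℝ),
          (n₀ : ℝ) ≤ C₀ * (1 + |Real.log ((L : ℝ) / δ)|) ^ k ∧
          ∀ l : ℕ, 1 ≤ l → l ≤ L - 1 → ∀ n : ℕ, n₀ < n →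
            ENNReal.ofReal (1 - δ) ≤
              initMeasure L (widths D n O L)
                {θ : Params L (widths D n O L) |
                  frobNorm (hiddenNTK L (widths D n O L) l θ x₁ x₂) ≤
                    C * (n : ℝ) * Real.sqrt n} := by
  set s : ℝ := (∑ j, x₁ j ^ 2) ^ 2 + (∑ j, x₂ j ^ 2) ^ 2 with hs
  have hK : ∀ l, 0 ≤ ntkMomentConst D s l := ntkMomentConst_nonneg (by positivity)
  refine ⟨0, 1, one_pos, fun δ hδ => ⟨0, √((∑ l ∈ Finset.range L, ntkMomentConst D s l + 1) / δ),
    by simp, fun l _ hlL n hn => ?_⟩⟩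
  have hl : l < L := by omega
  have hsum : ntkMomentConst D s l ≤ ∑ l ∈ Finset.range L, ntkMomentConst D s l :=
    Finset.single_le_sum (fun l _ => hK l) (Finset.mem_range.2 hl)
  have hpos : 0 < (∑ l ∈ Finset.range L, ntkMomentConst D s l + 1) / δ :=
    div_pos (by linarith [hK l]) hδ
  refine le_measure_frobNorm_le (B := ntkMomentConst D s l * (n : ℝ) ^ 3)
    (initMeasure L (widths D n O L))
    (measurable_sum_hiddenNTK_sq (w := widths D n O L) l x₁ x₂) hδ.le (by positivity) ?_ ?_
  · exact lintegral_sum_hiddenNTK_sq_le (w := widths D n O L) hn hD (fun l hl => if_pos hl)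
      x₁ x₂ hl
  · generalize ∑ l ∈ Finset.range L, ntkMomentConst D s l = T at *
    rw [mul_pow, mul_pow, Real.sq_sqrt hpos.le, Real.sq_sqrt (Nat.cast_nonneg n)]
    calc ntkMomentConst D s l * (n : ℝ) ^ 3 ≤ (T + 1) * (n : ℝ) ^ 3 := by gcongr; linarith
      _ = _ := by field_simp

end
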